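/- arXiv:1905.12461 — 2 statements merged into one kernel-verified Lean document; each statement's English description precedes it below -/
import Mathlib

section
/- For every m ≥ 1, the clique-width of U_3(m) is exactly 3, and the clique-width of the complement of U_3(m) is exactly 3. -/
namespace CWPaper

/-! ## Clique-width expressions -/

/-- Syntax of clique-width expressions.  Labels are natural numbers (`0`-indexed, so a
`k`-expression uses labels `0, …, k-1`). -/
inductive Expr : Type
  | vert : ℕ → Expr
  | union : Expr → Expr → Expr
  | join : ℕ → ℕ → Expr → Expr
  | relabel : ℕ → ℕ → Expr → Expr

namespace Expr

/-- The vertex set of an expression: one vertex per `vert` leaf. -/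
def Verts : Expr → Type
  | vert _ => Unit
  | union a b => Verts a ⊕ Verts b
  | join _ _ a => Verts a
  | relabel _ _ a => Verts a

/-- The label of each vertex after evaluating the expression. -/
def label : (e : Expr) → e.Verts → ℕ
  | vert i, _ => i
  | union a b, v => Sum.elim a.label b.label v
  | join _ _ a, v => a.label v
  | relabel i j a, v => if a.label v = i then j else a.label v

/-- The adjacency relation of the labeled graph built by the expression. -/
def adj : (e : Expr) → e.Verts → e.Verts → Prop
  | vert _, _, _ => False
  | union a b, u, v =>
      match u, v with
      | .inl u, .inl v => a.adj u v
      | .inr u, .inr v => b.adj u v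
      | _, _ => False
  | join i j a, u, v =>
      a.adj u v ∨ (a.label u = i ∧ a.label v = j) ∨ (a.label u = j ∧ a.label v = i)
  | relabel _ _ a, u, v => a.adj u v

/-- `e` is a `k`-expression: all labels used are among `0, …, k-1`, and joins use two
distinct labels. -/
def Valid (k : ℕ) : Expr → Prop
  | vert i => i < k
  | union a b => Valid k a ∧ Valid k b
  | join i j a => i < k ∧ j < k ∧ i ≠ j ∧ Valid k a
  | relabel i j a => i < k ∧ j < k ∧ Valid k a

/-- The expression `e` constructs the simple graph `G` (the final labels are ignored). -/
def Constructs (e : Expr) {V : Type*} (G : SimpleGraph V) : Prop :=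
  ∃ f : e.Verts ≃ V, ∀ u v, G.Adj (f u) (f v) ↔ e.adj u v

/-- The expression `e` constructs the graph `G` *split labeled* with respect to `(A, B)`:
every vertex of `A` ends with the first label (encoded `0`) and every vertex of `B` ends
with the second label (encoded `1`). -/
def ConstructsSplit (e : Expr) {V : Type*} (G : SimpleGraph V) (A B : Set V) : Prop :=
  ∃ f : e.Verts ≃ V, (∀ u v, G.Adj (f u) (f v) ↔ e.adj u v) ∧
    ∀ u, (f u ∈ A → e.label u = 0) ∧ (f u ∈ B → e.label u = 1)

end Expr

/-- The clique-width of a graph: the least `k` such that some `k`-expression constructs it. -/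
noncomputable def cliqueWidth {V : Type*} (G : SimpleGraph V) : ℕ :=
  sInf {k | ∃ e : Expr, e.Valid k ∧ e.Constructs G}

/-- The split clique-width of a splitted graph `(G, A, B)`: the least `k` such that some
`k`-expression constructs `G` split labeled. -/
noncomputable def splitCliqueWidth {V : Type*} (G : SimpleGraph V) (A B : Set V) : ℕ :=
  sInf {k | ∃ e : Expr, e.Valid k ∧ e.ConstructsSplit G A B}

/-! ## Splitted graphs and compositions -/

/-- `(G, A, B)` is a splitted graph: `A` and `B` partition the vertex set, `A` is a clique
and `B` is an independent set. -/
def IsSplitted {V : Type*} (G : SimpleGraph V) (A B : Set V) : Prop :=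
  A ∪ B = Set.univ ∧ Disjoint A B ∧
    (∀ a ∈ A, ∀ b ∈ A, a ≠ b → G.Adj a b) ∧ (∀ a ∈ B, ∀ b ∈ B, ¬ G.Adj a b)

/-- The composition `(G, A, B) ∘ H` of a splitted graph with a graph `H` on a disjoint
vertex set: take the disjoint union and add all edges between `A` and `V(H)`. -/
def comp {U W : Type*} (G : SimpleGraph U) (A : Set U) (H : SimpleGraph W) :
    SimpleGraph (U ⊕ W) :=
  SimpleGraph.fromRel fun x y =>
    match x, y with
    | .inl a, .inl b => G.Adj a b
    | .inr a, .inr b => H.Adj a b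
    | .inl a, .inr _ => a ∈ A
    | .inr _, .inl _ => False

/-- Inverting a splitted graph `(G, A, B)`: remove all edges inside `A` and add all edges
inside `B`.  The inverse splitted graph is `(splitInverse G A B, B, A)`. -/
def splitInverse {V : Type*} (G : SimpleGraph V) (A B : Set V) : SimpleGraph V :=
  SimpleGraph.fromRel fun x y =>
    (G.Adj x y ∧ ¬(x ∈ A ∧ y ∈ A)) ∨ (x ∈ B ∧ y ∈ B)

/-! ## Unigraphs -/

/-- The multiset of vertex degrees of a finite graph. -/
noncomputable def degreeMultiset (V : Type*) [Fintype V] (G : SimpleGraph V) : Multiset ℕ :=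
  (Finset.univ.val : Multiset V).map fun v => (G.neighborSet v).ncard

/-- A finite graph is a unigraph if every finite graph with the same degree multiset is
isomorphic to it. -/
def IsUnigraph {V : Type u} [Fintype V] (G : SimpleGraph V) : Prop :=
  ∀ (W : Type u) (_ : Fintype W) (H : SimpleGraph W),
    degreeMultiset W H = degreeMultiset V G → Nonempty (G ≃g H)

/-! ## Concrete graphs -/

/-- `mK2 m` : the disjoint union of `m` copies of `K₂`. -/
def mK2 (m : ℕ) : SimpleGraph (Fin m × Fin 2) :=
  SimpleGraph.fromRel fun x y => x.1 = y.1

/-- The star `K_{1,s}`; `none` is the center and the `some i` are the leaves. -/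
def starG (s : ℕ) : SimpleGraph (Option (Fin s)) :=
  SimpleGraph.fromRel fun x _ => x = none

/-- `U2 m s` : the disjoint union of `mK₂` and the star `K_{1,s}`. -/
def U2 (m s : ℕ) : SimpleGraph ((Fin m × Fin 2) ⊕ Option (Fin s)) :=
  SimpleGraph.fromRel fun x y =>
    match x, y with
    | .inl a, .inl b => a.1 = b.1
    | .inr a, .inr _ => a = none
    | _, _ => False

/-- `U3 m` : the disjoint union of `C₄` and `m` triangles with one vertex of each
component identified into the hub `none`.  The vertices `some (Sum.inl i)`, `i = 0, 1, 2`,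
are the remaining path of the `C₄` (so the hub is joined to its two endpoints), and
`some (Sum.inr (i, x))` are the two remaining vertices of the `i`-th triangle. -/
def U3 (m : ℕ) : SimpleGraph (Option (Fin 3 ⊕ Fin m × Fin 2)) :=
  SimpleGraph.fromRel fun x y =>
    match x, y with
    | none, some (.inl i) => i ≠ 1
    | none, some (.inr _) => True
    | some (.inl i), some (.inl j) => (i : ℕ) + 1 = (j : ℕ)
    | some (.inr a), some (.inr b) => a.1 = b.1
    | _, _ => False

/-- A graph is `P₄`-free if no four vertices induce a path on four vertices. -/
def P4Free {V : Type*} (G : SimpleGraph V) : Prop :=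
  IsEmpty (SimpleGraph.pathGraph 4 ↪g G)

/-! ## The split unigraphs `S₂`, `S₃`, `S₄` -/

/-- Vertices of `S₂`: the centers `Sum.inl ⟨i, j⟩` (`j`-th center of multiplicity block `i`)
and the leaves `Sum.inr ⟨i, j, x⟩` (`x`-th leaf of the star with center `⟨i, j⟩`). -/
def S2Verts (t : ℕ) (p q : Fin t → ℕ) : Type :=
  (Σ i : Fin t, Fin (q i)) ⊕ (Σ i : Fin t, Fin (q i) × Fin (p i))

/-- The center of the star a leaf belongs to. -/
def leafCenter {t : ℕ} {p q : Fin t → ℕ} (e : Σ i : Fin t, Fin (q i) × Fin (p i)) :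
    Σ i : Fin t, Fin (q i) :=
  ⟨e.1, e.2.1⟩

/-- The split graph `S₂(p₁, q₁; …; p_t, q_t)`: for each `i`, take `q i` disjoint stars
`K_{1, p i}` and join every two centers.  The clique is the set of centers
(`Set.range Sum.inl`) and the independent set is the set of leaves (`Set.range Sum.inr`). -/
def S2 (t : ℕ) (p q : Fin t → ℕ) : SimpleGraph (S2Verts t p q) :=
  SimpleGraph.fromRel fun x y =>
    match x, y with
    | .inl _, .inl _ => True
    | .inl c, .inr e => leafCenter e = c
    | _, _ => False

/-- The split graph `S₃(p, q₁; q₂)`: add to `S₂(p, q₁; p+1, q₂)` a new independent vertex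
`none` joined to exactly the `q₁` centers of the stars `K_{1,p}`. -/
def S3 (p q1 q2 : ℕ) : SimpleGraph (Option (S2Verts 2 ![p, p + 1] ![q1, q2])) :=
  SimpleGraph.fromRel fun x y =>
    match x, y with
    | some a, some b => (S2 2 ![p, p + 1] ![q1, q2]).Adj a b
    | none, some (.inl c) => c.1 = 0
    | _, _ => False

/-- The clique of the splitted graph `S₃(p, q₁; q₂)` (the star centers). -/
def S3A (p q1 q2 : ℕ) : Set (Option (S2Verts 2 ![p, p + 1] ![q1, q2])) :=
  {x | ∃ c, x = some (Sum.inl c)}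

/-- The independent set of the splitted graph `S₃(p, q₁; q₂)` (the leaves and the extra
vertex `none`). -/
def S3B (p q1 q2 : ℕ) : Set (Option (S2Verts 2 ![p, p + 1] ![q1, q2])) :=
  {x | x = none ∨ ∃ e, x = some (Sum.inr e)}

/-- The split graph `S₄(p, q)`: add to `S₃(p, 2; q)` a new clique vertex (the outer `none`)
joined to every vertex except itself and the special vertex `v` of `S₃` (here `some none`). -/
def S4 (p q : ℕ) : SimpleGraph (Option (Option (S2Verts 2 ![p, p + 1] ![2, q]))) :=
  SimpleGraph.fromRel fun x y =>
    match x, y with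
    | some a, some b => (S3 p 2 q).Adj a b
    | none, some (some _) => True
    | _, _ => False

/-- The clique of the splitted graph `S₄(p, q)` (the star centers and the new vertex `u`). -/
def S4A (p q : ℕ) : Set (Option (Option (S2Verts 2 ![p, p + 1] ![2, q]))) :=
  {x | x = none ∨ ∃ c, x = some (some (Sum.inl c))}

/-- The independent set of the splitted graph `S₄(p, q)` (the leaves and the vertex `v`). -/
def S4B (p q : ℕ) : Set (Option (Option (S2Verts 2 ![p, p + 1] ![2, q]))) :=
  {x | x = some none ∨ ∃ e, x = some (some (Sum.inr e))}

namespace Expr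

theorem Valid.mono {k l : ℕ} (h : k ≤ l) : ∀ {e : Expr}, e.Valid k → e.Valid l
  | vert _, he => lt_of_lt_of_le he h
  | union _ _, he => ⟨he.1.mono h, he.2.mono h⟩
  | join _ _ _, he => ⟨he.1.trans_le h, he.2.1.trans_le h, he.2.2.1, he.2.2.2.mono h⟩
  | relabel _ _ _, he => ⟨he.1.trans_le h, he.2.1.trans_le h, he.2.2.mono h⟩

theorem Valid.label_lt {k : ℕ} : ∀ {e : Expr}, e.Valid k → ∀ v, e.label v < k
  | vert _, he, _ => he
  | union _ _, he, .inl v => he.1.label_lt v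
  | union _ _, he, .inr v => he.2.label_lt v
  | join _ _ _, he, v => he.2.2.2.label_lt v
  | relabel i j a, he, v => by
      have := he.2.2.label_lt v
      simp only [label]
      split_ifs
      exacts [he.2.1, this]

/-- An expression with at most two labels creates no induced path on four vertices. -/
theorem Valid.no_induced_path : ∀ {e : Expr}, e.Valid 2 → ∀ a b c d : e.Verts,
    e.adj a b → e.adj b c → e.adj c d → ¬ e.adj a c → ¬ e.adj a d → ¬ e.adj b d → False
  | vert _, _, _, _, _, _, h, _, _, _, _, _ => h
  | union _ _, he, a, b, c, d, hab, hbc, hcd, hac, had, hbd => by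
      rcases a with a | a <;> rcases b with b | b <;> try exact hab.elim
      all_goals rcases c with c | c <;> try exact hbc.elim
      all_goals rcases d with d | d <;> try exact hcd.elim
      · exact he.1.no_induced_path a b c d hab hbc hcd hac had hbd
      · exact he.2.no_induced_path a b c d hab hbc hcd hac had hbd
  | join i j e, he, a, b, c, d, hab, hbc, hcd, hac, had, hbd => by
      obtain ⟨hi, hj, hij, he⟩ := he
      have la := he.label_lt a
      have lb := he.label_lt b
      have lc := he.label_lt c
      have ld := he.label_lt d
      have key := he.no_induced_path a b c d
      simp only [adj, not_or] at hab hbc hcd hac had hbd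
      have h1 : e.label a = e.label c := by omega
      have h2 : e.label a = e.label d := by omega
      have h3 : e.label b = e.label d := by omega
      exact key (hab.resolve_right (by omega)) (hbc.resolve_right (by omega))
        (hcd.resolve_right (by omega)) hac.1 had.1 hbd.1
  | relabel _ _ _, he, a, b, c, d, hab, hbc, hcd, hac, had, hbd =>
      he.2.2.no_induced_path a b c d hab hbc hcd hac had hbd

end Expr

/-- A `k`-expression builds, on the vertex set `S`, the graph with adjacency `A` and
labels `L`. -/
def Builds {V : Type*} (k : ℕ) (S : Set V) (A : V → V → Prop) (L : V → ℕ) : Prop :=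
  ∃ e : Expr, e.Valid k ∧ ∃ f : e.Verts → V, Function.Injective f ∧ Set.range f = S ∧
    (∀ u v, A (f u) (f v) ↔ e.adj u v) ∧ ∀ u, L (f u) = e.label u

namespace Builds

variable {V : Type*} {k : ℕ} {S T : Set V} {A B : V → V → Prop} {L M : V → ℕ}

theorem single (x : V) (hL : L x < k) (hA : ¬ A x x) : Builds k {x} A L :=
  ⟨.vert (L x), hL, fun _ => x, fun _ _ _ => rfl, @Set.range_const _ Unit _ x,
    fun _ _ => iff_of_false hA id, fun _ => rfl⟩

theorem union (hS : Builds k S A L) (hT : Builds k T A L) (hd : Disjoint S T)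
    (h : ∀ x ∈ S, ∀ y ∈ T, ¬ A x y ∧ ¬ A y x) : Builds k (S ∪ T) A L := by
  obtain ⟨e, he, f, hf, rfl, hA, hL⟩ := hS
  obtain ⟨e', he', f', hf', rfl, hA', hL'⟩ := hT
  refine ⟨.union e e', ⟨he, he'⟩, Sum.elim f f', hf.sumElim hf' fun a b hab => ?_,
    Set.Sum.elim_range f f', ?_, ?_⟩
  · exact Set.disjoint_left.1 hd ⟨a, rfl⟩ ⟨b, hab.symm⟩
  · rintro (u | u) (v | v)
    · exact hA u v
    · exact iff_of_false (h _ ⟨u, rfl⟩ _ ⟨v, rfl⟩).1 id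
    · exact iff_of_false (h _ ⟨v, rfl⟩ _ ⟨u, rfl⟩).2 id
    · exact hA' u v
  · rintro (u | u)
    · exact hL u
    · exact hL' u

theorem join (hS : Builds k S A L) (i j : ℕ) (hi : i < k) (hj : j < k) (hij : i ≠ j)
    (h : ∀ x ∈ S, ∀ y ∈ S, B x y ↔ A x y ∨ (L x = i ∧ L y = j) ∨ (L x = j ∧ L y = i)) :
    Builds k S B L := by
  obtain ⟨e, he, f, hf, rfl, hA, hL⟩ := hS
  refine ⟨.join i j e, ⟨hi, hj, hij, he⟩, f, hf, rfl, fun (u v : e.Verts) => ?_, hL⟩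
  have := h _ ⟨u, rfl⟩ _ ⟨v, rfl⟩
  rwa [hA, hL, hL] at this

theorem relabel (hS : Builds k S A L) (i j : ℕ) (hi : i < k) (hj : j < k)
    (h : ∀ x ∈ S, M x = if L x = i then j else L x) : Builds k S A M := by
  obtain ⟨e, he, f, hf, rfl, hA, hL⟩ := hS
  refine ⟨.relabel i j e, ⟨hi, hj, he⟩, f, hf, rfl, hA, fun (u : e.Verts) => ?_⟩
  have := h _ ⟨u, rfl⟩
  rwa [hL] at this

theorem congr (hS : Builds k S A L) (hB : ∀ x ∈ S, ∀ y ∈ S, B x y ↔ A x y)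
    (hM : ∀ x ∈ S, M x = L x) : Builds k S B M := by
  obtain ⟨e, he, f, hf, rfl, hA, hL⟩ := hS
  exact ⟨e, he, f, hf, rfl, fun u v => (hB _ ⟨u, rfl⟩ _ ⟨v, rfl⟩).trans (hA u v),
    fun u => (hM _ ⟨u, rfl⟩).trans (hL u)⟩

theorem exists_constructs {G : SimpleGraph V} (h : Builds k Set.univ G.Adj L) :
    ∃ e : Expr, e.Valid k ∧ e.Constructs G := by
  obtain ⟨e, he, f, hf, hr, hA, -⟩ := h
  exact ⟨e, he, Equiv.ofBijective f ⟨hf, Set.range_eq_univ.1 hr⟩, hA⟩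

end Builds

theorem cliqueWidth_eq_three {V : Type*} {G : SimpleGraph V} {L : V → ℕ}
    (h : Builds 3 Set.univ G.Adj L) (a b c d : V) (hab : G.Adj a b) (hbc : G.Adj b c)
    (hcd : G.Adj c d) (hac : ¬ G.Adj a c) (had : ¬ G.Adj a d) (hbd : ¬ G.Adj b d) :
    cliqueWidth G = 3 := by
  have h3 := h.exists_constructs
  refine le_antisymm (Nat.sInf_le h3) (le_csInf ⟨3, h3⟩ ?_)
  rintro k ⟨e, he, f, hf⟩
  by_contra! hk
  refine (he.mono (by omega : k ≤ 2)).no_induced_path (f.symm a) (f.symm b) (f.symm c)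
    (f.symm d) ?_ ?_ ?_ ?_ ?_ ?_ <;> simpa [← hf]

/-- The vertices of `U3 m` other than the hub and the triangles with index outside `F`. -/
def U3Part {m : ℕ} (F : Finset (Fin m)) : Set (Option (Fin 3 ⊕ Fin m × Fin 2)) :=
  {x | (∃ i, x = some (.inl i)) ∨ ∃ p : Fin m × Fin 2, p.1 ∈ F ∧ x = some (.inr p)}

/-- The labels used before the hub is joined: `0` for the hub, `2` for the vertex opposite
to it in the 4-cycle, and `1` for all other vertices. -/
def U3Label {m : ℕ} : Option (Fin 3 ⊕ Fin m × Fin 2) → ℕ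
  | none => 0
  | some (.inl i) => if i = 1 then 2 else 1
  | some (.inr _) => 1

theorem U3Part_empty {m : ℕ} : U3Part (∅ : Finset (Fin m)) =
    {some (.inl 0)} ∪ {some (.inl 2)} ∪ {some (.inl 1)} := by
  ext x
  simp [U3Part, Fin.exists_fin_succ]
  tauto

theorem U3Part_insert {m : ℕ} (i : Fin m) (F : Finset (Fin m)) : U3Part (insert i F) =
    U3Part F ∪ ({some (.inr (i, 0))} ∪ {some (.inr (i, 1))}) := by
  ext x
  rcases x with _ | _ | ⟨j, t⟩
  · simp [U3Part]
  · simp [U3Part]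
  · fin_cases t <;> simp [U3Part]

theorem U3Part_univ (m : ℕ) : U3Part (Finset.univ : Finset (Fin m)) ∪ {none} = Set.univ := by
  ext x
  rcases x with _ | _ | p
  · simp [U3Part]
  · simp [U3Part]
  · exact iff_of_true (.inl (.inr ⟨p, Finset.mem_univ _, rfl⟩)) trivial

/-- The vertices of `U3 m` other than the hub can be built with three labels. -/
theorem builds_U3Part {m : ℕ} (F : Finset (Fin m)) :
    Builds 3 (U3Part F) (U3 m).Adj U3Label := by
  induction F using Finset.induction_on with
  | empty =>
    rw [U3Part_empty]
    have h : Builds 3 _ (fun _ _ => False) (U3Label (m := m)) :=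
      (((Builds.single (some (.inl 0)) (by simp [U3Label]) id).union
        (.single (some (.inl 2)) (by simp [U3Label]) id) (by simp) (by simp)).union
        (.single (some (.inl 1)) (by simp [U3Label]) id) (by simp) (by simp))
    exact h.join 1 2 (by omega) (by omega) (by omega) (by simp [U3, U3Label])
  | insert i F hi ih =>
    rw [U3Part_insert]
    refine ih.union ?_ ?_ ?_
    · let L : Option (Fin 3 ⊕ Fin m × Fin 2) → ℕ :=
        fun x => if x = some (.inr (i, 0)) then 0 else 1
      have h : Builds 3 _ (fun _ _ => False) L :=
        (Builds.single (some (.inr (i, 0))) (by simp [L]) id).union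
          (.single (some (.inr (i, 1))) (by simp [L]) id) (by simp) (by simp)
      exact (h.join 0 1 (B := (U3 m).Adj) (by omega) (by omega) (by omega)
        (by simp [U3, L])).relabel 0 1 (by omega) (by omega) (by simp [L, U3Label])
    · rw [Set.disjoint_left]
      rintro x (⟨j, rfl⟩ | ⟨⟨j, t⟩, hj, rfl⟩) <;> simp
      grind
    · rintro x (⟨j, rfl⟩ | ⟨⟨j, t⟩, hj, rfl⟩) y (rfl | rfl) <;> simp [U3] <;> grind

/-- The vertices of the complement of `U3 m` other than the hub can be built with three
labels. -/
theorem builds_compl_U3Part {m : ℕ} (F : Finset (Fin m)) :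
    Builds 3 (U3Part F) (U3 m)ᶜ.Adj U3Label := by
  induction F using Finset.induction_on with
  | empty =>
    rw [U3Part_empty]
    let L : Option (Fin 3 ⊕ Fin m × Fin 2) → ℕ :=
      fun x => if x = some (.inl 0) then 0 else 1
    have h : Builds 3 _ (fun _ _ => False) L :=
      (Builds.single (some (.inl 0)) (by simp [L]) id).union
        (.single (some (.inl 2)) (by simp [L]) id) (by simp) (by simp)
    have h : Builds 3 _ (U3 m)ᶜ.Adj U3Label :=
      (h.join 0 1 (by omega) (by omega) (by omega) (by simp [U3, L])).relabel 0 1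
        (by omega) (by omega) (by simp [L, U3Label])
    exact h.union (.single _ (by simp [U3Label]) (by simp)) (by simp) (by simp [U3])
  | insert i F hi ih =>
    rw [U3Part_insert]
    let N : Set (Option (Fin 3 ⊕ Fin m × Fin 2)) :=
      {some (.inr (i, 0))} ∪ {some (.inr (i, 1))}
    let L : Option (Fin 3 ⊕ Fin m × Fin 2) → ℕ :=
      fun x => if x = some (.inr (i, 0)) ∨ x = some (.inr (i, 1)) then 0 else U3Label x
    let A : Option (Fin 3 ⊕ Fin m × Fin 2) → Option (Fin 3 ⊕ Fin m × Fin 2) → Prop :=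
      fun x y => (U3 m)ᶜ.Adj x y ∧ x ∉ N ∧ y ∉ N
    have hN : ∀ x ∈ U3Part F, x ∉ N := by
      rintro x (⟨j, rfl⟩ | ⟨⟨j, t⟩, hj, rfl⟩) <;> simp [N]
      grind
    have hF : Builds 3 (U3Part F) A L :=
      ih.congr (fun x hx y hy => by simp only [A, hN x hx, hN y hy]; simp)
        (fun x hx => if_neg (hN x hx))
    have hT : Builds 3 N A L :=
      (Builds.single _ (by simp [L]) (by simp [A])).union
        (.single _ (by simp [L]) (by simp [A])) (by simp) (by simp [A, N])
    have h := ((hF.union hT (Set.disjoint_left.2 hN)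
      (fun x _ y hy => ⟨fun h => h.2.2 hy, fun h => h.2.1 hy⟩)).join 0 1 (by omega) (by omega)
      (by omega) fun _ _ _ _ => Iff.rfl).join 0 2 (B := (U3 m)ᶜ.Adj) (by omega) (by omega)
      (by omega) ?_
    · refine h.relabel 0 1 (by omega) (by omega) ?_
      rintro x ((⟨j, rfl⟩ | ⟨⟨j, t⟩, hj, rfl⟩) | (rfl | rfl)) <;> simp [L, U3Label] <;> grind
    · rintro x ((⟨j, rfl⟩ | ⟨⟨j, t⟩, hj, rfl⟩) | (rfl | rfl)) y
        ((⟨j', rfl⟩ | ⟨⟨j', t'⟩, hj', rfl⟩) | (rfl | rfl)) <;>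
        simp [A, N, L, U3Label, U3] <;> grind

theorem stmt11 (m : ℕ) (hm : 1 ≤ m) :
    cliqueWidth (U3 m) = 3 ∧ cliqueWidth (U3 m)ᶜ = 3 := by
  constructor
  · have h : Builds 3 Set.univ (U3 m).Adj U3Label := by
      rw [← U3Part_univ m]
      let A : Option (Fin 3 ⊕ Fin m × Fin 2) → Option (Fin 3 ⊕ Fin m × Fin 2) → Prop :=
        fun x y => (U3 m).Adj x y ∧ x ≠ none ∧ y ≠ none
      have h : Builds 3 (U3Part Finset.univ ∪ {none}) A U3Label :=
        ((builds_U3Part Finset.univ).congr (by simp [A, U3Part]; grind) (by simp)).union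
          (.single none (by simp [U3Label]) (by simp [A])) (by simp [U3Part]) (by simp [A])
      refine h.join 0 1 (by omega) (by omega) (by omega) ?_
      rintro (_ | x | x) - (_ | y | y) - <;> simp [U3, U3Label, A] <;> grind
    exact cliqueWidth_eq_three h (some (.inl 1)) (some (.inl 0)) none
      (some (.inr (⟨0, hm⟩, 0))) (by simp [U3]) (by simp [U3]) (by simp [U3]) (by simp [U3])
      (by simp [U3]) (by simp [U3])
  · have h : Builds 3 Set.univ (U3 m)ᶜ.Adj U3Label := by
      rw [← U3Part_univ m]
      let A : Option (Fin 3 ⊕ Fin m × Fin 2) → Option (Fin 3 ⊕ Fin m × Fin 2) → Prop :=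
        fun x y => (U3 m)ᶜ.Adj x y ∧ x ≠ none ∧ y ≠ none
      have h : Builds 3 (U3Part Finset.univ ∪ {none}) A U3Label :=
        ((builds_compl_U3Part Finset.univ).congr (by simp [A, U3Part]; grind) (by simp)).union
          (.single none (by simp [U3Label]) (by simp [A])) (by simp [U3Part]) (by simp [A])
      refine h.join 0 2 (by omega) (by omega) (by omega) ?_
      rintro (_ | x | x) - (_ | y | y) - <;> simp [U3, U3Label, A] <;> grind
    exact cliqueWidth_eq_three h (some (.inl 0)) (some (.inr (⟨0, hm⟩, 0))) (some (.inl 1))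
      none (by simp [U3]) (by simp [U3]) (by simp [U3]) (by simp [U3])
      (by simp [U3]) (by simp [U3])

end CWPaper
end

section
/- For all parameters p_1, q_1, …, p_t, q_t ≥ 1 with t ≥ 1 and q_1 + ⋯ + q_t ≥ 2, the split clique-width of the inverse-complement of S_2(p_1, q_1; …; p_t, q_t) is at most 4. -/
namespace CWPaper

namespace Expr

/-- Some `k`-expression builds the graph with vertex set `S`, adjacency relation `R` and
labeling `lab`. -/
def Builds {V : Type*} (k : ℕ) (S : Set V) (R : V → V → Prop) (lab : V → ℕ) : Prop :=
  ∃ e : Expr, e.Valid k ∧ ∃ f : e.Verts → V, Function.Injective f ∧ Set.range f = S ∧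
    (∀ u v, R (f u) (f v) ↔ e.adj u v) ∧ ∀ u, e.label u = lab (f u)

namespace Builds

variable {V : Type*} {k : ℕ} {S T : Set V} {R R' : V → V → Prop} {lab lab' : V → ℕ}

theorem congr (h : Builds k S R lab) (hR : ∀ x ∈ S, ∀ y ∈ S, R x y ↔ R' x y)
    (hlab : ∀ x ∈ S, lab x = lab' x) : Builds k S R' lab' := by
  obtain ⟨e, he, f, hf, rfl, hadj, hl⟩ := h
  refine ⟨e, he, f, hf, rfl, fun u v => ?_, fun u => ?_⟩
  · rw [← hadj, hR _ ⟨u, rfl⟩ _ ⟨v, rfl⟩]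
  · rw [hl, hlab _ ⟨u, rfl⟩]

theorem singleton (x : V) (hR : ¬ R x x) (hk : lab x < k) : Builds k {x} R lab := by
  refine ⟨.vert (lab x), hk, fun _ => x, fun (_ : Unit) (_ : Unit) _ => rfl, ?_,
    fun _ _ => iff_of_false hR id, fun _ => rfl⟩
  have : Nonempty (Expr.vert (lab x)).Verts := ⟨()⟩
  exact Set.range_const

theorem union (hS : Builds k S R lab) (hT : Builds k T R lab) (hST : Disjoint S T)
    (hR : ∀ x ∈ S, ∀ y ∈ T, ¬ R x y ∧ ¬ R y x) : Builds k (S ∪ T) R lab := by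
  obtain ⟨a, ha, f, hf, rfl, hadj, hl⟩ := hS
  obtain ⟨b, hb, g, hg, rfl, hadj', hl'⟩ := hT
  refine ⟨.union a b, ⟨ha, hb⟩, Sum.elim f g, ?_, Set.Sum.elim_range f g, ?_, ?_⟩
  · exact hf.sumElim hg fun u v h => Set.disjoint_left.1 hST ⟨u, rfl⟩ ⟨v, h.symm⟩
  · rintro (u | u) (v | v)
    · exact hadj u v
    · exact iff_of_false (hR _ ⟨u, rfl⟩ _ ⟨v, rfl⟩).1 id
    · exact iff_of_false (hR _ ⟨v, rfl⟩ _ ⟨u, rfl⟩).2 id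
    · exact hadj' u v
  · rintro (u | u)
    · exact hl u
    · exact hl' u

theorem join (h : Builds k S R lab) {i j : ℕ} (hi : i < k) (hj : j < k) (hij : i ≠ j) :
    Builds k S (fun x y => R x y ∨ (lab x = i ∧ lab y = j) ∨ (lab x = j ∧ lab y = i)) lab := by
  obtain ⟨e, he, f, hf, hS, hadj, hl⟩ := h
  refine ⟨.join i j e, ⟨hi, hj, hij, he⟩, f, hf, hS, fun u v => ?_, hl⟩
  have h : ∀ u v : e.Verts, (R (f u) (f v) ∨ (lab (f u) = i ∧ lab (f v) = j) ∨
      (lab (f u) = j ∧ lab (f v) = i)) ↔ (e.adj u v ∨ (e.label u = i ∧ e.label v = j) ∨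
      (e.label u = j ∧ e.label v = i)) := fun u v => by
    rw [hadj, hl, hl]
  exact h u v

theorem relabel (h : Builds k S R lab) {i j : ℕ} (hi : i < k) (hj : j < k) :
    Builds k S R (fun x => if lab x = i then j else lab x) := by
  obtain ⟨e, he, f, hf, hS, hadj, hl⟩ := h
  refine ⟨.relabel i j e, ⟨hi, hj, he⟩, f, hf, hS, hadj, fun u => ?_⟩
  have h : ∀ u : e.Verts, (if e.label u = i then j else e.label u) =
      if lab (f u) = i then j else lab (f u) := fun u => by
    rw [hl]
  exact h u

theorem of_edgeless (hfin : S.Finite) (hne : S.Nonempty) (hR : ∀ x ∈ S, ∀ y ∈ S, ¬ R x y)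
    (hk : ∀ x ∈ S, lab x < k) : Builds k S R lab := by
  induction S, hfin using Set.Finite.induction_on with
  | empty => exact absurd hne Set.not_nonempty_empty
  | @insert a S ha _ ih =>
    have hs : Builds k {a} R lab := singleton a (hR a (by simp) a (by simp)) (hk a (by simp))
    rcases S.eq_empty_or_nonempty with rfl | hS
    · simpa using hs
    · rw [Set.insert_eq]
      refine hs.union (ih hS (fun x hx y hy => hR x (.inr hx) y (.inr hy))
        fun x hx => hk x (.inr hx)) (by simpa using ha) ?_
      rintro x rfl y hy
      exact ⟨hR _ (.inl rfl) y (.inr hy), hR y (.inr hy) _ (.inl rfl)⟩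

open Classical in
/-- A graph whose vertices are grouped by a map `c`, with two vertices adjacent exactly when
they lie in different groups and at least one of them lies in `A`, is built with four labels,
ending with label `0` on `A` and label `1` off `A`. -/
theorem of_fibers {C : Type*} [Finite V] (c : V → C) (hc : Function.Surjective c) (A : Set V)
    (s : Finset C) (hs : s.Nonempty) :
    Builds 4 {x | c x ∈ s} (fun x y => c x ≠ c y ∧ (x ∈ A ∨ y ∈ A))
      (fun x => if x ∈ A then 0 else 1) := by
  induction hs using Finset.Nonempty.cons_induction with
  | singleton a =>
    obtain ⟨v, hv⟩ := hc a
    refine of_edgeless (Set.toFinite _) ⟨v, by simp [hv]⟩ ?_ ?_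
    · simp +contextual
    · intro x _
      split_ifs <;> norm_num
  | cons a s ha _ ih =>
    obtain ⟨v, hv⟩ := hc a
    have hS : Builds 4 {x | c x ∈ s}
        (fun x y => c x ≠ a ∧ c y ≠ a ∧ c x ≠ c y ∧ (x ∈ A ∨ y ∈ A))
        (fun x => if c x = a then (if x ∈ A then 2 else 3) else (if x ∈ A then 0 else 1)) := by
      refine ih.congr ?_ ?_ <;> grind
    have hT : Builds 4 {x | c x = a}
        (fun x y => c x ≠ a ∧ c y ≠ a ∧ c x ≠ c y ∧ (x ∈ A ∨ y ∈ A))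
        (fun x => if c x = a then (if x ∈ A then 2 else 3) else (if x ∈ A then 0 else 1)) := by
      refine of_edgeless (Set.toFinite _) ⟨v, hv⟩ ?_ ?_ <;> grind
    have hST := hS.union hT (Set.disjoint_left.2 (by grind)) (by grind)
    have heq : {x | c x ∈ Finset.cons a s ha} = {x | c x ∈ s} ∪ {x | c x = a} := by
      ext x
      simp [or_comm]
    rw [heq]
    have hJ := ((hST.join (i := 0) (j := 2) (by norm_num) (by norm_num) (by norm_num)).join
      (i := 0) (j := 3) (by norm_num) (by norm_num) (by norm_num)).join
      (i := 1) (j := 2) (by norm_num) (by norm_num) (by norm_num)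
    refine ((hJ.relabel (i := 2) (j := 0) (by norm_num) (by norm_num)).relabel
      (i := 3) (j := 1) (by norm_num) (by norm_num)).congr ?_ ?_
    · intro x hx y hy
      by_cases hxa : c x = a <;> by_cases hya : c y = a <;> by_cases hxA : x ∈ A <;>
        by_cases hyA : y ∈ A <;> simp [hxa, hya, hxA, hyA, eq_comm (a := a)]
    · intro x _
      by_cases hxa : c x = a <;> by_cases hxA : x ∈ A <;> simp [hxa, hxA]

end Builds

end Expr

/-- The center of the star of `S₂` a vertex belongs to. -/
def starCenter {t : ℕ} {p q : Fin t → ℕ} : S2Verts t p q → Σ i : Fin t, Fin (q i) :=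
  Sum.elim id leafCenter

theorem compl_splitInverse_adj {V : Type*} (G : SimpleGraph V) (A B : Set V) (x y : V) :
    (splitInverse G A B)ᶜ.Adj x y ↔
      x ≠ y ∧ (x ∈ A ∧ y ∈ A ∨ ¬ G.Adj x y) ∧ ¬ (x ∈ B ∧ y ∈ B) := by
  simp only [splitInverse, SimpleGraph.compl_adj, SimpleGraph.fromRel_adj, G.adj_comm y x]
  tauto

theorem compl_splitInverse_S2_adj {t : ℕ} {p q : Fin t → ℕ} (x y : S2Verts t p q) :
    (splitInverse (S2 t p q) (Set.range Sum.inl) (Set.range Sum.inr))ᶜ.Adj x y ↔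
      starCenter x ≠ starCenter y ∧
        (x ∈ Set.range Sum.inl ∨ y ∈ Set.range Sum.inl) := by
  rw [compl_splitInverse_adj]
  unfold S2
  rw [SimpleGraph.fromRel_adj]
  unfold S2Verts at *
  rcases x with x | x <;> rcases y with y | y <;>
    simp [starCenter, eq_comm]

theorem stmt16 (t : ℕ) (ht : 1 ≤ t) (p q : Fin t → ℕ)
    (hp : ∀ i, 1 ≤ p i) (hq : ∀ i, 1 ≤ q i) (hsum : 2 ≤ ∑ i, q i) :
    splitCliqueWidth (splitInverse (S2 t p q) (Set.range Sum.inl) (Set.range Sum.inr))ᶜ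
      (Set.range Sum.inl) (Set.range Sum.inr) ≤ 4 := by
  classical
  have : Finite (S2Verts t p q) := by
    unfold S2Verts
    infer_instance
  obtain ⟨e, he, f, hf, hrange, hadj, hl⟩ :=
    Expr.Builds.of_fibers (starCenter (p := p) (q := q)) (fun c => ⟨Sum.inl c, rfl⟩)
      (Set.range Sum.inl) Finset.univ ⟨⟨⟨0, ht⟩, ⟨0, hq _⟩⟩, Finset.mem_univ _⟩
  have hsurj : Function.Surjective f := by
    rw [← Set.range_eq_univ, hrange]
    simp
  refine Nat.sInf_le ⟨e, he, Equiv.ofBijective f ⟨hf, hsurj⟩, fun u v => ?_, fun u => ?_⟩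
  · exact (compl_splitInverse_S2_adj _ _).trans (hadj u v)
  · rw [hl]
    refine ⟨fun h => if_pos h, fun h => if_neg ?_⟩
    obtain ⟨b, hb⟩ := h
    rintro ⟨a, ha⟩
    exact Sum.inl_ne_inr (ha.trans hb.symm)

end CWPaper
end
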